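/- The following series evaluation holds: Σ_{n=1}^{∞} (16/27)^n · [(1)_n^3 / ((1/2)_n (1/3)_n (2/3)_n)] · (11n−3)/n³ = 8π². -/

import Mathlib

open Real

/-- Rising factorial `(a)ₙ = a(a+1)⋯(a+n−1)`. -/
noncomputable def pochR (a : ℝ) (n : ℕ) : ℝ := ∏ i ∈ Finset.range n, (a + i)

/-- The general term of the series (for `n ≥ 1`). -/
noncomputable def sunTerm (n : ℕ) : ℝ :=
  (16/27 : ℝ)^n * (pochR 1 n ^ 3 /
    (pochR (1/2) n * pochR (1/3) n * pochR (2/3) n)) * (11*(n : ℝ) - 3) / (n : ℝ)^3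

/-- ratio in `k` of the WZ kernel -/
noncomputable def wzr (n k : ℕ) : ℝ := (k + 1/2 - n) * (k + 1/2) / (n + k + 3/2)^2

/-- ratio in `n` of the WZ kernel -/
noncomputable def wzs (n k : ℕ) : ℝ :=
  -(4 * (2*n+1)^2 * (n+1)^3) / (3 * (3*n+1) * (3*n+2) * (k - n - 1/2) * (n + k + 3/2)^2)

/-- boundary value `F n 0` -/
noncomputable def wzc : ℕ → ℝ
  | 0 => 4
  | n + 1 => wzc n * wzs n 0

/-- the WZ kernel -/
noncomputable def wzF (n : ℕ) : ℕ → ℝ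
  | 0 => wzc n
  | k + 1 => wzF n k * wzr n k

noncomputable def wzq (n : ℕ) : ℝ := (2*n+1)^2 / (3 * (3*n+1) * (3*n+2))

noncomputable def wzR (n k : ℕ) : ℝ :=
  ((4 * wzq n - 1) * (n+1) + (k + 1/2) * (1 - 3 * wzq n)) / (k - n - 1/2) + (k + 1/2) / (3*n+1)

lemma half_ne (n k : ℕ) : (k : ℝ) - n - 1/2 ≠ 0 := by
  intro h
  have h2 : (2 * k : ℝ) = 2 * n + 1 := by linarith
  have h3 : 2 * k = 2 * n + 1 := by exact_mod_cast h2
  omega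

lemma wzF_n (n k : ℕ) : wzF (n+1) k = wzF n k * wzs n k := by
  induction k with
  | zero => simp [wzF, wzc]
  | succ k ih =>
    simp only [wzF, ih]
    have key : wzs n k * wzr (n+1) k = wzr n k * wzs n (k+1) := by
      unfold wzs wzr
      have h1 := half_ne n k
      have h2 := half_ne n (k+1)
      push_cast at h2 ⊢
      have e1 : (k:ℝ) + 1/2 - (n+1) = k - n - 1/2 := by ring
      have e2 : (k:ℝ) + 1 - n - 1/2 = k + 1/2 - n := by ring
      rw [e2] at h2
      rw [e1, e2]
      have h3 : (n:ℝ) + k + 3/2 ≠ 0 := by positivity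
      have h4 : (n:ℝ) + 1 + k + 3/2 ≠ 0 := by positivity
      have h4' : (n:ℝ) + (k + 1) + 3/2 = n + 1 + k + 3/2 := by ring
      rw [h4']
      have h5 : (3*(n:ℝ)+1) ≠ 0 := by positivity
      have h6 : (3*(n:ℝ)+2) ≠ 0 := by positivity
      generalize (n:ℝ) + k + 3/2 = X at *
      generalize (n:ℝ) + 1 + k + 3/2 = Y at *
      generalize (k:ℝ) - n - 1/2 = Z at *
      generalize (k:ℝ) + 1/2 - n = W at *
      field_simp
    rw [mul_assoc, key, mul_assoc]

lemma wz (n k : ℕ) : wzF (n+1) k - wzF n k = wzF n (k+1) * wzR n (k+1) - wzF n k * wzR n k := by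
  rw [wzF_n]
  simp only [wzF]
  have key : wzs n k - 1 = wzr n k * wzR n (k+1) - wzR n k := by
    unfold wzs wzr wzR wzq
    have h1 := half_ne n k
    have h2 := half_ne n (k+1)
    push_cast at h2 ⊢
    have e2 : (k:ℝ) + 1 - n - 1/2 = k + 1/2 - n := by ring
    rw [e2] at h2
    rw [e2]
    have h3 : (n:ℝ) + k + 3/2 ≠ 0 := by positivity
    have h5 : (3*(n:ℝ)+1) ≠ 0 := by positivity
    have h6 : (3*(n:ℝ)+2) ≠ 0 := by positivity
    generalize hm : (k:ℝ) - n - 1/2 = Z at *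
    generalize hx : (n:ℝ) + k + 3/2 = X at *
    generalize hw : (k:ℝ) + 1/2 - n = W at *
    field_simp
    subst hm hx hw
    ring
  linear_combination (wzF n k) * key

lemma wzc_pos (n : ℕ) : 0 < wzc n := by
  induction n with
  | zero => simp [wzc]
  | succ n ih =>
    simp only [wzc]
    apply mul_pos ih
    unfold wzs
    have : (((0:ℕ):ℝ) - n - 1/2) = -(n + 1/2) := by push_cast; ring
    rw [this, mul_neg, neg_mul, neg_div_neg_eq]
    positivity

lemma wzs_le (n : ℕ) : wzs n 0 ≤ 4/5 := by
  unfold wzs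
  have : (((0:ℕ):ℝ) - n - 1/2) = -(n + 1/2) := by push_cast; ring
  rw [this, mul_neg, neg_mul, neg_div_neg_eq, div_le_iff₀ (by positivity)]
  push_cast
  have hn : (0:ℝ) ≤ n := by positivity
  have : 0 ≤ (2*(n:ℝ)+1) * (28*n^4+152*n^3+231*n^2+115*n+14) := by positivity
  nlinarith [this]

lemma wzc_le (n : ℕ) : wzc n ≤ 4 * (4/5)^n := by
  induction n with
  | zero => simp [wzc]
  | succ n ih =>
    simp only [wzc]
    calc wzc n * wzs n 0 ≤ wzc n * (4/5) := by
          apply mul_le_mul_of_nonneg_left (wzs_le n) (wzc_pos n).le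
      _ ≤ 4 * (4/5)^n * (4/5) := by gcongr
      _ = _ := by ring

lemma wzr_abs (n k : ℕ) : |wzr n k| ≤ (k + 1/2) / (k + 5/2) := by
  unfold wzr
  have hk : (0:ℝ) ≤ k := by positivity
  rw [abs_div, abs_mul, abs_of_pos (show (0:ℝ) < k + 1/2 by positivity),
    abs_of_pos (show (0:ℝ) < (n + k + 3/2)^2 by positivity)]
  rw [div_le_div_iff₀ (by positivity) (by positivity)]
  rcases Nat.eq_zero_or_pos n with rfl | h
  · push_cast
    rw [abs_of_pos (by linarith)]
    nlinarith
  · have hn : (1:ℝ) ≤ n := by exact_mod_cast h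
    have h1 : |(k:ℝ) + 1/2 - n| ≤ n + k + 3/2 := by
      rw [abs_le]; constructor <;> linarith
    have h2 : (k:ℝ) + 5/2 ≤ n + k + 3/2 := by linarith
    have h3 : |(k:ℝ) + 1/2 - n| * (k + 5/2) ≤ (n + k + 3/2) * (n + k + 3/2) := by gcongr
    nlinarith

lemma wzF_abs (n k : ℕ) : |wzF n k| ≤ wzc n * (1 / ((k + 1/2) * (k + 3/2))) := by
  suffices h : |wzF n k| ≤ wzc n * ((3/4) / ((k + 1/2) * (k + 3/2))) by
    refine h.trans ?_
    have := (wzc_pos n).le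
    gcongr
    norm_num
  induction k with
  | zero => simp [wzF, abs_of_pos (wzc_pos n)]; norm_num
  | succ k ih =>
    simp only [wzF]
    rw [abs_mul]
    calc |wzF n k| * |wzr n k| ≤ wzc n * ((3/4) / ((k + 1/2) * (k + 3/2))) * ((k + 1/2) / (k + 5/2)) := by
          have := (wzc_pos n).le
          exact mul_le_mul ih (wzr_abs n k) (abs_nonneg _) (by positivity)
      _ = _ := by
          push_cast
          have e : (k:ℝ) + 1 + 1/2 = k + 3/2 := by ring
          have e' : (k:ℝ) + 1 + 3/2 = k + 5/2 := by ring
          rw [e, e']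
          field_simp

lemma odd_sum : HasSum (fun k : ℕ => 1 / ((k:ℝ) + 1/2)^2) (π^2/2) := by
  have hz := hasSum_zeta_two
  have he : HasSum (fun k : ℕ => 1 / (((2 * k : ℕ) : ℝ))^2) (π^2/6/4) := by
    have := hz.div_const 4
    have e : (fun k : ℕ => 1 / (((2 * k : ℕ) : ℝ))^2) = fun k : ℕ => 1 / (k:ℝ)^2 / 4 := by
      funext k
      push_cast
      rw [mul_pow, div_div]; congr 1; ring
    rw [e]; exact this
  have hs : Summable (fun k : ℕ => 1 / (((2 * k + 1 : ℕ) : ℝ))^2) :=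
    hz.summable.comp_injective (i := fun k : ℕ => 2 * k + 1) (fun a b h => by simpa using h)
  have ho := hs.hasSum
  have hsum := HasSum.even_add_odd (f := fun n : ℕ => 1 / ((n:ℝ))^2) he ho
  have hv := hsum.unique hz
  have := ho.mul_left 4
  have e : (fun k : ℕ => 1 / ((k:ℝ) + 1/2)^2)
      = fun k : ℕ => 4 * (1 / (((2 * k + 1 : ℕ) : ℝ))^2) := by
    funext k
    push_cast
    have : (2 * (k:ℝ) + 1) = 2 * (k + 1/2) := by ring
    rw [this, mul_pow]; field_simp; norm_num
  have e2 : π^2/2 = 4 * ∑' b : ℕ, 1 / (((2 * b + 1 : ℕ) : ℝ))^2 := by linarith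
  rw [e, e2]; exact this

lemma base_summable : Summable (fun k : ℕ => 1 / (((k:ℝ) + 1/2) * (k + 3/2))) := by
  refine Summable.of_nonneg_of_le (fun k => by positivity) (fun k => ?_) odd_sum.summable
  apply one_div_le_one_div_of_le (by positivity)
  have hk : (0:ℝ) ≤ k := by positivity
  nlinarith

lemma wzF_summable (n : ℕ) : Summable (wzF n) :=
  Summable.of_norm_bounded (base_summable.mul_left (wzc n)) (fun k => by
    rw [Real.norm_eq_abs]; exact wzF_abs n k)

lemma wzF_zero (k : ℕ) : wzF 0 k = 1 / ((k:ℝ) + 1/2)^2 := by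
  induction k with
  | zero => simp [wzF, wzc]; norm_num
  | succ k ih =>
    simp only [wzF, ih, wzr]
    push_cast
    have e : (k:ℝ) + 1 + 1/2 = k + 3/2 := by ring
    rw [e, sub_zero, zero_add]
    field_simp

open Filter Topology in
lemma wzG_tendsto (n : ℕ) : Tendsto (fun k => wzF n k * wzR n k) atTop (𝓝 0) := by
  set B := (4 * wzq n - 1) * ((n:ℝ)+1) with hB
  set s := 1 - 3 * wzq n with hs
  set K := 4 * |B| + 2 * |s| + 1 with hK
  have hlim : Tendsto (fun k : ℕ => wzc n * K * (1 / ((k:ℝ) + 1))) atTop (𝓝 0) := by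
    simpa using (tendsto_one_div_add_atTop_nhds_zero_nat (𝕜 := ℝ)).const_mul (wzc n * K)
  refine squeeze_zero_norm' ?_ hlim
  filter_upwards [eventually_ge_atTop (n+1)] with k hk
  have hk' : (n:ℝ) + 1 ≤ k := by exact_mod_cast hk
  have hc := (wzc_pos n).le
  have hR : |wzR n k| ≤ K * (k + 1/2) := by
    unfold wzR
    rw [← hB, ← hs]
    have hd : (1/2 : ℝ) ≤ k - n - 1/2 := by linarith
    have h1 : |(B + (k + 1/2) * s) / (k - n - 1/2)| ≤ (|B| + (k + 1/2) * |s|) * 2 := by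
      rw [abs_div, abs_of_pos (show (0:ℝ) < k - n - 1/2 by linarith), div_le_iff₀ (by linarith)]
      have h2 : |B + (k + 1/2) * s| ≤ |B| + (k + 1/2) * |s| := by
        refine (abs_add_le _ _).trans ?_
        rw [abs_mul ((k:ℝ) + 1/2) s, abs_of_pos (show (0:ℝ) < k + 1/2 by positivity)]
      have h3 : 0 ≤ |B| + (k + 1/2) * |s| := by positivity
      nlinarith
    have h4 : |((k:ℝ) + 1/2) / (3*n+1)| ≤ k + 1/2 := by
      rw [abs_of_nonneg (by positivity)]
      apply div_le_self (by positivity)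
      have : (0:ℝ) ≤ n := by positivity
      linarith
    refine (abs_add_le _ _).trans ?_
    have h5 : (0:ℝ) ≤ k := by positivity
    rw [hK]
    nlinarith [abs_nonneg B, mul_nonneg h5 (abs_nonneg B)]
  rw [Real.norm_eq_abs, abs_mul]
  calc |wzF n k| * |wzR n k| ≤ wzc n * (1 / ((k + 1/2) * (k + 3/2))) * (K * (k + 1/2)) :=
        mul_le_mul (wzF_abs n k) hR (abs_nonneg _) (by positivity)
    _ = wzc n * K * (1 / ((k:ℝ) + 3/2)) := by field_simp
    _ ≤ _ := by
      gcongr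
      norm_num

open Filter Topology in
lemma wz_step (n : ℕ) : (∑' k, wzF n k) - (∑' k, wzF (n+1) k) = wzF n 0 * wzR n 0 := by
  have h := ((wzF_summable (n+1)).sub (wzF_summable n)).hasSum.tendsto_sum_nat
  have h2 : Tendsto (fun N => ∑ k ∈ Finset.range N, (wzF (n+1) k - wzF n k)) atTop
      (𝓝 (0 - wzF n 0 * wzR n 0)) := by
    have : ∀ N, ∑ k ∈ Finset.range N, (wzF (n+1) k - wzF n k)
        = wzF n N * wzR n N - wzF n 0 * wzR n 0 := by
      intro N
      rw [← Finset.sum_range_sub (fun k => wzF n k * wzR n k)]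
      exact Finset.sum_congr rfl (fun k _ => wz n k)
    simp only [this]
    exact (wzG_tendsto n).sub_const _
  have h3 := tendsto_nhds_unique h h2
  rw [(wzF_summable (n+1)).tsum_sub (wzF_summable n)] at h3
  linarith

lemma poch_succ (a : ℝ) (n : ℕ) : pochR a (n+1) = pochR a n * (a + n) := by
  simp [pochR, Finset.prod_range_succ]

lemma poch_pos (a : ℝ) (ha : 0 < a) (n : ℕ) : 0 < pochR a n :=
  Finset.prod_pos (fun i _ => by positivity)

lemma wzc_closed (n : ℕ) : (16/27 : ℝ)^(n+1) * (pochR 1 (n+1) ^ 3 /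
    (pochR (1/2) (n+1) * pochR (1/3) (n+1) * pochR (2/3) (n+1))) / ((n:ℝ)+1)^3
    = wzc n * (8 * (2*n+1) / (3 * (3*n+1) * (3*n+2))) := by
  induction n with
  | zero => simp [pochR, wzc]; norm_num
  | succ n ih =>
    rw [poch_succ 1, poch_succ (1/2), poch_succ (1/3), poch_succ (2/3), pow_succ]
    have p1 := poch_pos 1 (by norm_num) (n+1)
    have p2 := poch_pos (1/2) (by norm_num) (n+1)
    have p3 := poch_pos (1/3) (by norm_num) (n+1)
    have p4 := poch_pos (2/3) (by norm_num) (n+1)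
    simp only [wzc, wzs]
    have e : (((0:ℕ):ℝ) - n - 1/2) = -(n + 1/2) := by push_cast; ring
    rw [e, mul_neg, neg_mul, neg_div_neg_eq]
    have hc : wzc n = (16/27 : ℝ)^(n+1) * (pochR 1 (n+1) ^ 3 /
      (pochR (1/2) (n+1) * pochR (1/3) (n+1) * pochR (2/3) (n+1))) / ((n:ℝ)+1)^3
        / (8 * (2*n+1) / (3 * (3*n+1) * (3*n+2))) := by
      rw [ih]; field_simp
    rw [hc]
    push_cast
    generalize pochR 1 (n+1) = P1 at *
    generalize pochR (1/2) (n+1) = P2 at *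
    generalize pochR (1/3) (n+1) = P3 at *
    generalize pochR (2/3) (n+1) = P4 at *
    generalize (16/27 : ℝ)^(n+1) = T at *
    field_simp
    ring

lemma sun_eq (n : ℕ) : sunTerm (n+1) = 16 * (wzF n 0 * wzR n 0) := by
  have h := wzc_closed n
  have : sunTerm (n+1) = (16/27 : ℝ)^(n+1) * (pochR 1 (n+1) ^ 3 /
    (pochR (1/2) (n+1) * pochR (1/3) (n+1) * pochR (2/3) (n+1))) / ((n:ℝ)+1)^3 * (11 * n + 8) := by
    unfold sunTerm
    push_cast
    ring
  rw [this, h]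
  simp only [wzF, wzR, wzq]
  have e : (((0:ℕ):ℝ) - n - 1/2) = -(n + 1/2) := by push_cast; ring
  rw [e, div_neg]
  push_cast
  field_simp
  ring

open Filter Topology in
lemma S_tendsto : Tendsto (fun n => ∑' k, wzF n k) atTop (𝓝 0) := by
  set M := ∑' k : ℕ, 1 / (((k:ℝ) + 1/2) * (k + 3/2)) with hM
  have hM0 : 0 ≤ M := tsum_nonneg (fun k => by positivity)
  have hlim : Tendsto (fun n : ℕ => 4 * M * (4/5 : ℝ)^n) atTop (𝓝 0) := by
    simpa using (tendsto_pow_atTop_nhds_zero_of_lt_one (r := (4/5:ℝ)) (by norm_num)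
      (by norm_num)).const_mul (4 * M)
  refine squeeze_zero_norm (fun n => ?_) hlim
  have h := tsum_of_norm_bounded (base_summable.hasSum.mul_left (wzc n)) (f := wzF n) (fun k => by
    rw [Real.norm_eq_abs]; exact wzF_abs n k)
  refine h.trans ?_
  calc wzc n * M ≤ 4 * (4/5)^n * M := by gcongr; exact wzc_le n
    _ = _ := by ring

open Filter Topology in
theorem sun_series_eight_pi_sq :
    ∑' n : ℕ, sunTerm (n+1) = 8 * π^2 := by
  have hnn : ∀ n : ℕ, 0 ≤ sunTerm (n+1) := by
    intro n
    unfold sunTerm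
    have p1 := poch_pos 1 (by norm_num) (n+1)
    have p2 := poch_pos (1/2) (by norm_num) (n+1)
    have p3 := poch_pos (1/3) (by norm_num) (n+1)
    have p4 := poch_pos (2/3) (by norm_num) (n+1)
    have : 0 ≤ 11 * (((n+1 : ℕ)) : ℝ) - 3 := by
      push_cast
      have : (0:ℝ) ≤ n := by positivity
      linarith
    positivity
  apply HasSum.tsum_eq
  rw [hasSum_iff_tendsto_nat_of_nonneg hnn]
  have hp : ∀ N, ∑ n ∈ Finset.range N, sunTerm (n+1)
      = 16 * ((∑' k, wzF 0 k) - ∑' k, wzF N k) := by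
    intro N
    rw [← Finset.sum_range_sub' (fun n => ∑' k, wzF n k), Finset.mul_sum]
    exact Finset.sum_congr rfl (fun n _ => by rw [sun_eq, wz_step])
  simp only [hp]
  have h0 : ∑' k, wzF 0 k = π^2/2 := by
    rw [← odd_sum.tsum_eq]
    exact tsum_congr wzF_zero
  rw [h0]
  have := (S_tendsto.const_sub (π^2/2)).const_mul 16
  convert this using 2
  ring
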